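/- arXiv:1503.07310 — 2 statements merged into one kernel-verified Lean document; each statement's English description precedes it below -/
import Mathlib

section
/- Let Γ be a reduct of (𝕃;C) such that C is primitive positive definable in Γ. Then the relation N is primitive positive definable in Γ if and only if some expansion of Γ by finitely many constants admits a primitive positive interpretation of ({0,1}; NAE). -/
/-! ### Relational structures and primitive positive formulas -/

/-- A relational structure with relation symbols `σ`, arities `ar`, and domain `D`. -/
structure RelStruct (σ : Type) (ar : σ → ℕ) (D : Type) where
  rel : (s : σ) → (Fin (ar s) → D) → Prop

/-- Primitive positive formulas over the relational signature `(σ, ar)`, with `n` free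
variables (built from atomic formulas using only conjunction and existential
quantification). -/
inductive PPFormula (σ : Type) (ar : σ → ℕ) : ℕ → Type
  | eq {n : ℕ} (i j : Fin n) : PPFormula σ ar n
  | rel {n : ℕ} (s : σ) (v : Fin (ar s) → Fin n) : PPFormula σ ar n
  | and {n : ℕ} (φ ψ : PPFormula σ ar n) : PPFormula σ ar n
  | ex {n : ℕ} (φ : PPFormula σ ar (n + 1)) : PPFormula σ ar n

/-- Satisfaction of a primitive positive formula in a structure, under an assignment. -/
def PPFormula.Realize {σ : Type} {ar : σ → ℕ} {D : Type} (Γ : RelStruct σ ar D) :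
    {n : ℕ} → PPFormula σ ar n → (Fin n → D) → Prop
  | _, .eq i j, t => t i = t j
  | _, .rel s v, t => Γ.rel s (fun m => t (v m))
  | _, .and φ ψ, t => φ.Realize Γ t ∧ ψ.Realize Γ t
  | _, .ex φ, t => ∃ d : D, φ.Realize Γ (Fin.snoc t d)

/-- A relation is primitive positive definable in `Γ` if it is the set of solutions of a
primitive positive formula over the signature of `Γ`. -/
def PPDefinable {σ : Type} {ar : σ → ℕ} {D : Type} (Γ : RelStruct σ ar D) {n : ℕ}
    (R : (Fin n → D) → Prop) : Prop :=
  ∃ φ : PPFormula σ ar n, ∀ t, R t ↔ φ.Realize Γ t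

/-- The expansion of a structure by the constants `a 0, …, a (n-1)`, realised as new
singleton unary relations. -/
def RelStruct.withConstants {σ : Type} {ar : σ → ℕ} {D : Type} (Γ : RelStruct σ ar D)
    {n : ℕ} (a : Fin n → D) : RelStruct (σ ⊕ Fin n) (Sum.elim ar fun _ => 1) D where
  rel s := match s with
    | .inl s => fun t => Γ.rel s t
    | .inr i => fun t : Fin 1 → D => t 0 = a i

/-- Flattening a `k`-tuple of `d`-tuples into a `(k*d)`-tuple. -/
def flattenTuple {D : Type} {k d : ℕ} (ts : Fin k → Fin d → D) : Fin (k * d) → D :=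
  fun j => ts (finProdFinEquiv.symm j).1 (finProdFinEquiv.symm j).2

/-- A primitive positive interpretation of the structure `Δ` in the structure `Γ`:
a dimension `dim`, a primitive positive domain formula, primitive positive defining
formulas for equality and for each atomic formula, and a coordinate map, surjective
onto `Δ`, from the `dim`-tuples satisfying the domain formula. -/
structure PPInterpretation {σ₁ : Type} {ar₁ : σ₁ → ℕ} {D : Type} (Γ : RelStruct σ₁ ar₁ D)
    {σ₂ : Type} {ar₂ : σ₂ → ℕ} {E : Type} (Δ : RelStruct σ₂ ar₂ E) : Type where
  dim : ℕ
  domFml : PPFormula σ₁ ar₁ dim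
  eqFml : PPFormula σ₁ ar₁ (2 * dim)
  relFml : (s : σ₂) → PPFormula σ₁ ar₁ (ar₂ s * dim)
  coord : (Fin dim → D) → E
  coord_surj : ∀ e : E, ∃ t, domFml.Realize Γ t ∧ coord t = e
  eq_iff : ∀ t₁ t₂ : Fin dim → D, domFml.Realize Γ t₁ → domFml.Realize Γ t₂ →
    (coord t₁ = coord t₂ ↔ eqFml.Realize Γ (flattenTuple ![t₁, t₂]))
  rel_iff : ∀ (s : σ₂) (ts : Fin (ar₂ s) → Fin dim → D),
    (∀ i, domFml.Realize Γ (ts i)) →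
    (Δ.rel s (fun i => coord (ts i)) ↔ (relFml s).Realize Γ (flattenTuple ts))

/-- The Boolean structure `({0,1}; NAE)`, where `NAE = {0,1}³ \ {(0,0,0),(1,1,1)}`. -/
def NAEStruct : RelStruct Unit (fun _ => 3) Bool where
  rel := fun _ t => (∃ i, t i = true) ∧ (∃ i, t i = false)
/-! ### First-order formulas, ω-categoricity, model-complete cores -/

/-- First-order formulas over the relational signature `(σ, ar)` with `n` free variables. -/
inductive FOFormula (σ : Type) (ar : σ → ℕ) : ℕ → Type
  | eq {n : ℕ} (i j : Fin n) : FOFormula σ ar n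
  | rel {n : ℕ} (s : σ) (v : Fin (ar s) → Fin n) : FOFormula σ ar n
  | not {n : ℕ} (φ : FOFormula σ ar n) : FOFormula σ ar n
  | and {n : ℕ} (φ ψ : FOFormula σ ar n) : FOFormula σ ar n
  | ex {n : ℕ} (φ : FOFormula σ ar (n + 1)) : FOFormula σ ar n

/-- Satisfaction of a first-order formula in a structure, under an assignment. -/
def FOFormula.Realize {σ : Type} {ar : σ → ℕ} {D : Type} (Γ : RelStruct σ ar D) :
    {n : ℕ} → FOFormula σ ar n → (Fin n → D) → Prop
  | _, .eq i j, t => t i = t j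
  | _, .rel s v, t => Γ.rel s (fun m => t (v m))
  | _, .not φ, t => ¬ φ.Realize Γ t
  | _, .and φ ψ, t => φ.Realize Γ t ∧ ψ.Realize Γ t
  | _, .ex φ, t => ∃ d : D, φ.Realize Γ (Fin.snoc t d)

/-- A relation is first-order definable in `Γ` if it is the set of solutions of a
first-order formula over the signature of `Γ`. -/
def FODefinable {σ : Type} {ar : σ → ℕ} {D : Type} (Γ : RelStruct σ ar D) {n : ℕ}
    (R : (Fin n → D) → Prop) : Prop :=
  ∃ φ : FOFormula σ ar n, ∀ t, R t ↔ φ.Realize Γ t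

/-- Isomorphism of relational structures over the same signature. -/
def RelStruct.Isomorphic {σ : Type} {ar : σ → ℕ} {D E : Type}
    (Γ : RelStruct σ ar D) (Δ : RelStruct σ ar E) : Prop :=
  ∃ g : D ≃ E, ∀ (s : σ) (t : Fin (ar s) → D), Γ.rel s t ↔ Δ.rel s (fun i => g (t i))

/-- A countable structure is ω-categorical if all countable models of its first-order
theory are isomorphic (to it). -/
def IsOmegaCategorical {σ : Type} {ar : σ → ℕ} {D : Type} (Γ : RelStruct σ ar D) : Prop :=
  Countable D ∧ ∀ (E : Type) (Δ : RelStruct σ ar E), Countable E →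
    (∀ φ : FOFormula σ ar 0, φ.Realize Γ Fin.elim0 → φ.Realize Δ Fin.elim0) →
    Γ.Isomorphic Δ

/-- A self-map of the domain of `Γ` is an elementary self-embedding if it preserves the
truth of all first-order formulas. -/
def IsElementarySelfEmbedding {σ : Type} {ar : σ → ℕ} {D : Type} (Γ : RelStruct σ ar D)
    (e : D → D) : Prop :=
  ∀ {n : ℕ} (φ : FOFormula σ ar n) (t : Fin n → D),
    φ.Realize Γ t ↔ φ.Realize Γ (fun i => e (t i))

/-- A homomorphism between relational structures over the same signature. -/
def IsHom {σ : Type} {ar : σ → ℕ} {D E : Type} (Γ : RelStruct σ ar D) (Δ : RelStruct σ ar E)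
    (h : D → E) : Prop :=
  ∀ (s : σ) (t : Fin (ar s) → D), Γ.rel s t → Δ.rel s (fun i => h (t i))

/-- Two structures are homomorphically equivalent if there are homomorphisms in both
directions. -/
def HomEquiv {σ : Type} {ar : σ → ℕ} {D E : Type} (Γ : RelStruct σ ar D)
    (Δ : RelStruct σ ar E) : Prop :=
  (∃ h, IsHom Γ Δ h) ∧ (∃ h, IsHom Δ Γ h)

/-- A structure is a model-complete core if all its endomorphisms are elementary
self-embeddings. -/
def IsModelCompleteCore {σ : Type} {ar : σ → ℕ} {D : Type} (Γ : RelStruct σ ar D) : Prop :=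
  ∀ e : D → D, IsHom Γ Γ e → IsElementarySelfEmbedding Γ e
/-! ### C-relations

`C z x y` encodes `C(z; x, y)`, also written `xy|z`: the smallest subtree containing
`x` and `y` does not contain `z`. -/

/-- The Adeleke–Neumann axioms for a C-relation. -/
def IsCRelation {L : Type} (C : L → L → L → Prop) : Prop :=
  (∀ z x y, C z x y → C z y x) ∧
  (∀ z x y, C z x y → ¬ C y x z) ∧
  (∀ z x y, C z x y → ∀ w, C w x y ∨ C z w y) ∧
  (∀ z x, x ≠ z → C z x x)

/-- A C-relation is binary branching if for pairwise distinct `x, y, z` one of the three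
groupings `xy|z`, `xz|y`, `yz|x` holds (by the axioms, exactly one then holds). -/
def IsBinaryBranching {L : Type} (C : L → L → L → Prop) : Prop :=
  ∀ x y z : L, x ≠ y → x ≠ z → y ≠ z → C z x y ∨ C y x z ∨ C x y z

/-- Density of a C-relation. -/
def IsDenseC {L : Type} (C : L → L → L → Prop) : Prop :=
  ∀ x y z, C x y z → ∃ w, C x w z ∧ C w y z

/-- An automorphism of `(L; C)`. -/
def IsCAutomorphism {L : Type} (C : L → L → L → Prop) (g : L → L) : Prop :=
  Function.Bijective g ∧ ∀ z x y, C (g z) (g x) (g y) ↔ C z x y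

/-- `(L; C)` is homogeneous: every isomorphism between finite induced substructures
extends to an automorphism. -/
def IsCHomogeneous {L : Type} (C : L → L → L → Prop) : Prop :=
  ∀ (A : Finset L) (f : L → L), Set.InjOn f ↑A →
    (∀ z ∈ A, ∀ x ∈ A, ∀ y ∈ A, C z x y ↔ C (f z) (f x) (f y)) →
    ∃ g : L → L, IsCAutomorphism C g ∧ ∀ a ∈ A, g a = f a

/-- `(L; C)` is (isomorphic to) the countable homogeneous binary branching dense
C-relation `(𝕃; C)`. -/
def IsHomBBDenseC {L : Type} (C : L → L → L → Prop) : Prop :=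
  Countable L ∧ Infinite L ∧ IsCRelation C ∧ IsBinaryBranching C ∧
    IsDenseC C ∧ IsCHomogeneous C

/-- The relation `N(x,y,z)` iff `xy|z` or `x|yz`. -/
def NRel {L : Type} (C : L → L → L → Prop) (x y z : L) : Prop := C z x y ∨ C x y z

/-- The quartet relation `Q(x,y,z,t)` iff (`xy|z` and `xy|t`) or (`zt|x` and `zt|y`). -/
def QRel {L : Type} (C : L → L → L → Prop) (x y z t : L) : Prop :=
  (C z x y ∧ C t x y) ∨ (C x z t ∧ C y z t)

/-- The restriction `Q_d` of the quartet relation to quadruples of pairwise distinct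
elements. -/
def QdRel {L : Type} (C : L → L → L → Prop) (x y z t : L) : Prop :=
  x ≠ y ∧ x ≠ z ∧ x ≠ t ∧ y ≠ z ∧ y ≠ t ∧ z ≠ t ∧ QRel C x y z t

/-- The structure `(L; C)` with a single ternary relation. -/
def CStruct {L : Type} (C : L → L → L → Prop) : RelStruct Unit (fun _ => 3) L where
  rel := fun _ t => C (t 0) (t 1) (t 2)

/-- The structure `(L; N)` with a single ternary relation. -/
def NStruct {L : Type} (C : L → L → L → Prop) : RelStruct Unit (fun _ => 3) L where
  rel := fun _ t => NRel C (t 0) (t 1) (t 2)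

/-- The structure `(L; Q_d)` with a single quaternary relation. -/
def QdStruct {L : Type} (C : L → L → L → Prop) : RelStruct Unit (fun _ => 4) L where
  rel := fun _ t => QdRel C (t 0) (t 1) (t 2) (t 3)
/-- A reduct of `(L; C)`: a relational structure on `L` all of whose relations are
first-order definable in `(L; C)`. -/
def IsReduct {L : Type} (C : L → L → L → Prop) {σ : Type} {ar : σ → ℕ}
    (Γ : RelStruct σ ar L) : Prop :=
  ∀ s, FODefinable (CStruct C) (Γ.rel s)
section Helpers

namespace PPFormula

variable {σ : Type} {ar : σ → ℕ} {D : Type}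

def relabel : {n : ℕ} → PPFormula σ ar n → {m : ℕ} → (Fin n → Fin m) → PPFormula σ ar m
  | _, .eq i j, _, g => .eq (g i) (g j)
  | _, .rel s v, _, g => .rel s (fun k => g (v k))
  | _, .and φ ψ, _, g => .and (φ.relabel g) (ψ.relabel g)
  | _, .ex φ, m, g => .ex (φ.relabel (Fin.snoc (α := fun _ => Fin (m+1)) (fun i => (g i).castSucc) (Fin.last m)))

theorem realize_relabel (Γ : RelStruct σ ar D) {n : ℕ} (φ : PPFormula σ ar n) :
    ∀ {m : ℕ} (g : Fin n → Fin m) (t : Fin m → D),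
      (φ.relabel g).Realize Γ t ↔ φ.Realize Γ (fun i => t (g i)) := by
  induction φ with
  | eq i j => intro m g t; exact Iff.rfl
  | rel s v => intro m g t; exact Iff.rfl
  | and φ ψ h1 h2 => intro m g t; exact and_congr (h1 g t) (h2 g t)
  | ex φ ih =>
    intro m g t
    refine exists_congr fun d => ?_
    rw [ih]
    apply iff_of_eq
    congr 1
    funext i
    refine Fin.lastCases ?_ (fun i => ?_) i <;> simp

end PPFormula

def PD {σ : Type} {ar : σ → ℕ} {D : Type} (Γ : RelStruct σ ar D) {ι : Type}
    (R : (ι → D) → Prop) : Prop :=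
  ∃ (n : ℕ) (e : Fin n ≃ ι) (φ : PPFormula σ ar n), ∀ t, R t ↔ φ.Realize Γ (fun i => t (e i))

namespace PD

variable {σ : Type} {ar : σ → ℕ} {D : Type} {Γ : RelStruct σ ar D} {ι κ : Type}

theorem of_pp {n : ℕ} {R : (Fin n → D) → Prop} (h : PPDefinable Γ R) : PD Γ R := by
  obtain ⟨φ, h⟩ := h
  exact ⟨n, Equiv.refl _, φ, h⟩

theorem congr {R S : (ι → D) → Prop} (h : PD Γ R) (hRS : ∀ t, S t ↔ R t) : PD Γ S := by
  obtain ⟨n, e, φ, h⟩ := h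
  exact ⟨n, e, φ, fun t => (hRS t).trans (h t)⟩

/-- can choose the enumeration -/
theorem enum {R : (ι → D) → Prop} (h : PD Γ R) [Finite κ] (g : ι → κ) {m : ℕ} (e : Fin m ≃ κ) :
    ∃ φ : PPFormula σ ar m, ∀ t : κ → D, R (fun i => t (g i)) ↔ φ.Realize Γ (fun i => t (e i)) := by
  obtain ⟨n, e0, φ, h⟩ := h
  refine ⟨φ.relabel (fun i => e.symm (g (e0 i))), fun t => ?_⟩
  rw [PPFormula.realize_relabel, h]
  simp

theorem to_pp {n : ℕ} {R : (Fin n → D) → Prop} (h : PD Γ R) : PPDefinable Γ R := by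
  obtain ⟨φ, h⟩ := h.enum (κ := Fin n) id (Equiv.refl _)
  exact ⟨φ, h⟩

theorem reindex {R : (ι → D) → Prop} (h : PD Γ R) [Finite κ] (g : ι → κ) :
    PD Γ (fun t : κ → D => R (fun i => t (g i))) := by
  obtain ⟨m, ⟨e⟩⟩ := Finite.exists_equiv_fin κ
  obtain ⟨φ, h⟩ := h.enum g e.symm
  exact ⟨m, e.symm, φ, h⟩

theorem fin {R : (ι → D) → Prop} (h : PD Γ R) : Finite ι := by
  obtain ⟨n, e, _⟩ := h
  exact Finite.of_equiv _ e

theorem and {R S : (ι → D) → Prop} (h : PD Γ R) (h' : PD Γ S) : PD Γ (fun t => R t ∧ S t) := by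
  have := h.fin
  obtain ⟨n, e, φ, h⟩ := h
  obtain ⟨ψ, h'⟩ := h'.enum id e
  exact ⟨n, e, .and φ ψ, fun t => and_congr (h t) (h' t)⟩

theorem eq [Finite ι] (i j : ι) : PD Γ (fun t : ι → D => t i = t j) := by
  obtain ⟨m, ⟨e⟩⟩ := Finite.exists_equiv_fin ι
  refine ⟨m, e.symm, .eq (e i) (e j), fun t => ?_⟩
  simp [PPFormula.Realize]

theorem ex [Finite ι] {R : (Option ι → D) → Prop} (h : PD Γ R) :
    PD Γ (fun t : ι → D => ∃ d, R (fun o => o.elim d t)) := by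
  obtain ⟨m, ⟨e⟩⟩ := Finite.exists_equiv_fin ι
  obtain ⟨n, e0, φ, h⟩ := h
  refine ⟨m, e.symm, .ex (φ.relabel (fun i => (e0 i).elim (Fin.last m) (fun j => (e j).castSucc))),
    fun t => exists_congr fun d => ?_⟩
  rw [PPFormula.realize_relabel, h]
  apply iff_of_eq
  congr 1
  funext i
  cases e0 i <;> simp

theorem exs [hι : Finite ι] : ∀ {κ : Type} [Finite κ] {R : (κ ⊕ ι → D) → Prop}, PD Γ R →
    PD Γ (fun s : κ → D => ∃ t : ι → D, R (Sum.elim s t)) := by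
  refine Finite.induction_empty_option (P := fun ι => ∀ {κ : Type} [Finite κ]
    {R : (κ ⊕ ι → D) → Prop}, PD Γ R → PD Γ (fun s : κ → D => ∃ t : ι → D, R (Sum.elim s t)))
    ?_ ?_ ?_ ι
  · intro α β e hα κ _ R h
    have : Finite (κ ⊕ α) := by
      have := h.fin
      exact Finite.of_equiv _ (Equiv.sumCongr (Equiv.refl κ) e).symm
    refine (hα (h.reindex (Sum.map id e.symm))).congr fun s => ?_
    constructor
    · rintro ⟨t, ht⟩
      refine ⟨fun i => t (e i), ?_⟩
      convert ht using 1
      funext i; cases i <;> simp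
    · rintro ⟨t, ht⟩
      refine ⟨fun i => t (e.symm i), ?_⟩
      convert ht using 1
      funext i; cases i <;> simp
  · intro κ _ R h
    refine (h.reindex (κ := κ) (Sum.elim id PEmpty.elim)).congr fun s => ?_
    constructor
    · rintro ⟨t, ht⟩
      convert ht using 1
      funext i; rcases i with i | i
      · simp
      · exact i.elim
    · intro ht
      refine ⟨PEmpty.elim, ?_⟩
      convert ht using 1
      funext i; rcases i with i | i
      · simp
      · exact i.elim
  · intro α _ ih κ _ R h
    have h2 := (ih (κ := Option κ) (h.reindex (κ := Option κ ⊕ α)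
      (Sum.elim (fun k => Sum.inl (some k)) (fun o => o.elim (Sum.inl none) Sum.inr)))).ex
    refine h2.congr fun s => ?_
    constructor
    · rintro ⟨t, ht⟩
      refine ⟨t none, fun i => t (some i), ?_⟩
      convert ht using 1
      funext i; rcases i with i | _ | i <;> simp
    · rintro ⟨d, t, ht⟩
      refine ⟨fun o => o.elim d t, ?_⟩
      convert ht using 1
      funext i; rcases i with i | _ | i <;> simp

theorem all {β : Type} [Finite β] {R : (ι → D) → Prop} (h : PD Γ R) {A : β → (ι → D) → Prop}
    (hA : ∀ b, PD Γ (A b)) : PD Γ (fun t => R t ∧ ∀ b, A b t) := by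
  have := Fintype.ofFinite β
  classical
  have key : ∀ s : Finset β, PD Γ (fun t => R t ∧ ∀ b ∈ s, A b t) := by
    intro s
    induction s using Finset.induction_on with
    | empty => exact h.congr (by simp)
    | insert b s _ ih =>
      refine (ih.and (hA b)).congr fun t => ?_
      simp only [Finset.mem_insert, forall_eq_or_imp]
      tauto
  exact (key Finset.univ).congr (by simp)

/-- restrict a family of conditions to those with a certain side property -/
theorem all' {β : Type} [Finite β] {R : (ι → D) → Prop} (h : PD Γ R) {A : β → (ι → D) → Prop}
    (P : β → Prop) (hA : ∀ b, PD Γ (A b)) : PD Γ (fun t => R t ∧ ∀ b, P b → A b t) := by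
  refine (all h (β := {b // P b}) (A := fun b => A b.1) (fun b => hA b.1)).congr fun t => ?_
  simp

theorem proj {R : (ι → D) → Prop} (h : PD Γ R) [Finite κ] (g : κ → ι) :
    PD Γ (fun s : κ → D => ∃ t, R t ∧ ∀ k, t (g k) = s k) := by
  have := h.fin
  have h1 := all (β := κ) (h.reindex (κ := κ ⊕ ι) Sum.inr)
    (A := fun k t => t (Sum.inr (g k)) = t (Sum.inl k)) (fun k => eq _ _)
  exact (exs h1).congr fun s => by simp

theorem withConst {R : (ι → D) → Prop} (h : PD Γ R) {n : ℕ} (a : Fin n → D) :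
    PD (Γ.withConstants a) R := by
  obtain ⟨m, e, φ, h⟩ := h
  have key : ∀ {m : ℕ} (φ : PPFormula σ ar m),
      ∃ ψ : PPFormula (σ ⊕ Fin n) (Sum.elim ar fun _ => 1) m,
      ∀ t, φ.Realize Γ t ↔ ψ.Realize (Γ.withConstants a) t := by
    intro m φ
    induction φ with
    | eq i j => exact ⟨.eq i j, fun t => Iff.rfl⟩
    | rel s v => exact ⟨.rel (Sum.inl s) v, fun t => Iff.rfl⟩
    | and φ ψ h1 h2 =>
      obtain ⟨a1, h1⟩ := h1
      obtain ⟨a2, h2⟩ := h2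
      exact ⟨.and a1 a2, fun t => and_congr (h1 t) (h2 t)⟩
    | ex φ ih =>
      obtain ⟨a1, h1⟩ := ih
      exact ⟨.ex a1, fun t => exists_congr fun d => h1 _⟩
  obtain ⟨ψ, hψ⟩ := key φ
  exact ⟨m, e, ψ, fun t => (h t).trans (hψ _)⟩

theorem const {n : ℕ} (a : Fin n → D) [Finite ι] (i : ι) (k : Fin n) :
    PD (Γ.withConstants a) (fun t : ι → D => t i = a k) := by
  obtain ⟨m, ⟨e⟩⟩ := Finite.exists_equiv_fin ι
  refine ⟨m, e.symm, .rel (Sum.inr k) (fun _ => e i), fun t => ?_⟩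
  simp [PPFormula.Realize, RelStruct.withConstants]

theorem subst [Finite ι] {n : ℕ} {R : (ι ⊕ Fin n → D) → Prop} (h : PD Γ R) (a : Fin n → D) :
    PD (Γ.withConstants a) (fun t : ι → D => R (Sum.elim t a)) := by
  have h1 := exs (all (β := Fin n) (h.withConst a) (A := fun k t => t (Sum.inr k) = a k)
    (fun k => const a _ _))
  refine h1.congr fun s => ⟨fun h => ⟨a, h, by simp⟩, ?_⟩
  rintro ⟨t, h, h'⟩
  have : t = a := funext h'
  rwa [← this]

/-- formulas with constants are pp over the tuple of constants -/
theorem unconst {n k : ℕ} (φ : PPFormula (σ ⊕ Fin n) (Sum.elim ar fun _ => 1) k) :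
    PD Γ (fun t : Fin k ⊕ Fin n → D =>
      φ.Realize (Γ.withConstants (fun i => t (Sum.inr i))) (fun i => t (Sum.inl i))) := by
  induction φ with
  | eq i j => exact eq _ _
  | rel s v =>
    rcases s with s | s
    · have : PD Γ (fun t : Fin (ar s) → D => Γ.rel s t) :=
        ⟨_, Equiv.refl _, .rel s id, fun t => Iff.rfl⟩
      exact this.reindex (fun i => Sum.inl (v i))
    · exact eq (Sum.inl (v (0 : Fin 1))) (Sum.inr s)
  | and φ ψ h1 h2 => exact h1.and h2
  | @ex k φ ih =>
    have := (ih.reindex (κ := Option (Fin k ⊕ Fin n))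
      (Sum.elim (Fin.snoc (α := fun _ => Option (Fin k ⊕ Fin n)) (fun i => some (Sum.inl i)) none)
        (fun i => some (Sum.inr i)))).ex
    refine this.congr fun t => exists_congr fun d => ?_
    apply iff_of_eq
    congr 1
    funext i
    refine Fin.lastCases ?_ (fun i => ?_) i <;> simp

end PD

section CLemmas

variable {L : Type} {C : L → L → L → Prop}

theorem IsHomBBDenseC.symm (hL : IsHomBBDenseC C) {x y z : L} (h : C z x y) : C z y x :=
  hL.2.2.1.1 _ _ _ h

theorem IsHomBBDenseC.asymm (hL : IsHomBBDenseC C) {x y z : L} (h : C z x y) : ¬ C y x z :=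
  hL.2.2.1.2.1 _ _ _ h

theorem IsHomBBDenseC.cut (hL : IsHomBBDenseC C) {x y z : L} (h : C z x y) (w : L) :
    C w x y ∨ C z w y :=
  hL.2.2.1.2.2.1 _ _ _ h w

theorem IsHomBBDenseC.self (hL : IsHomBBDenseC C) {x z : L} (h : z ≠ x) : C z x x :=
  hL.2.2.1.2.2.2 _ _ h.symm

theorem IsHomBBDenseC.ne1 (hL : IsHomBBDenseC C) {x y z : L} (h : C z x y) : z ≠ x := by
  rintro rfl
  exact hL.asymm (hL.symm h) (hL.symm h)

theorem IsHomBBDenseC.ne2 (hL : IsHomBBDenseC C) {x y z : L} (h : C z x y) : z ≠ y :=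
  hL.ne1 (hL.symm h)

theorem IsHomBBDenseC.tri (hL : IsHomBBDenseC C) {x y z : L} (h : x ≠ z) :
    C z x y ∨ C y x z ∨ C x y z := by
  by_cases h1 : x = y
  · subst h1; exact Or.inl (hL.self h.symm)
  by_cases h2 : y = z
  · subst h2; exact Or.inr (Or.inr (hL.self h))
  exact hL.2.2.2.1 x y z h1 h h2

theorem IsHomBBDenseC.trans' (hL : IsHomBBDenseC C) {x y z w : L} (h : C z x y) (h' : C z y w) :
    C z x w := by
  rcases hL.cut (hL.symm h) w with h1 | h1
  · rcases hL.cut h' x with h2 | h2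
    · exact absurd h1 (hL.asymm h2)
    · exact h2
  · exact hL.symm h1

theorem IsHomBBDenseC.move (hL : IsHomBBDenseC C) {x y z x' z' : L} (h : C z' y x)
    (h' : C z' x' x) (h'' : C x' z z') : C z y x := by
  rcases hL.cut h z with h1 | h1
  · exact h1
  · exact absurd (hL.trans' h1 (hL.symm h')) (hL.asymm h'')

theorem IsHomBBDenseC.hom_ext (hL : IsHomBBDenseC C) {ι : Type} [Finite ι] (X Y : ι → L)
    (h1 : ∀ i j, X i = X j → Y i = Y j)
    (h2 : ∀ i j k, C (X i) (X j) (X k) → C (Y i) (Y j) (Y k)) :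
    ∃ g : L → L, IsCAutomorphism C g ∧ ∀ i, g (X i) = Y i := by
  classical
  have := Fintype.ofFinite ι
  have h1' : ∀ i j, Y i = Y j → X i = X j := by
    intro i j h
    by_contra hne
    exact hL.ne1 (h2 i j j (hL.self hne)) h
  have h2' : ∀ i j k, C (Y i) (Y j) (Y k) → C (X i) (X j) (X k) := by
    intro i j k h
    have hij : X i ≠ X j := fun e => hL.ne1 h (h1 _ _ e)
    rcases hL.tri (y := X k) hij with h' | h' | h'
    · exact absurd (h2 _ _ _ h') (fun h'' => hL.asymm (hL.symm h) (hL.symm h''))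
    · exact absurd (h2 _ _ _ h') (fun h'' => hL.asymm h (hL.symm h''))
    · exact hL.symm h'
  let f : L → L := fun l => if h : ∃ i, X i = l then Y h.choose else l
  have hf : ∀ i, f (X i) = Y i := by
    intro i
    have h : ∃ j, X j = X i := ⟨i, rfl⟩
    simp only [f, dif_pos h]
    exact h1 _ _ h.choose_spec
  obtain ⟨g, hg, hgf⟩ := hL.2.2.2.2.2 (Finset.univ.image X) f (by
      intro a ha b hb hab
      simp only [Finset.coe_image, Finset.coe_univ, Set.image_univ, Set.mem_range] at ha hb
      obtain ⟨i, rfl⟩ := ha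
      obtain ⟨j, rfl⟩ := hb
      rw [hf, hf] at hab
      exact h1' _ _ hab) (by
      intro a ha b hb c hc
      simp only [Finset.mem_image, Finset.mem_univ, true_and] at ha hb hc
      obtain ⟨i, rfl⟩ := ha
      obtain ⟨j, rfl⟩ := hb
      obtain ⟨k, rfl⟩ := hc
      rw [hf, hf, hf]
      exact ⟨h2 _ _ _, h2' _ _ _⟩)
  refine ⟨g, hg, fun i => ?_⟩
  rw [hgf _ (by simp), hf]

theorem IsHomBBDenseC.two_trans (hL : IsHomBBDenseC C) {x z x' z' : L}
    (h : x = z ↔ x' = z') :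
    ∃ g : L → L, IsCAutomorphism C g ∧ g x = x' ∧ g z = z' := by
  obtain ⟨g, hg, h'⟩ := hL.hom_ext ![x, z] ![x', z']
    (by
      intro i j
      fin_cases i <;> fin_cases j <;> simp <;> grind)
    (by
      intro i j k hc
      have hc1 := hL.ne1 hc
      have hc2 := hL.ne2 hc
      have : ∀ {a b : L}, a ≠ b → C a b b := fun h => hL.self h
      fin_cases i <;> fin_cases j <;> fin_cases k <;> simp at hc hc1 hc2 ⊢ <;>
        apply this <;> grind)
  exact ⟨g, hg, h' 0, h' 1⟩

theorem PPFormula.realize_iso {σ : Type} {ar : σ → ℕ} {D : Type} {Γ Γ' : RelStruct σ ar D}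
    {g : D → D} (hg : Function.Bijective g)
    (h : ∀ s t, Γ'.rel s (fun i => g (t i)) ↔ Γ.rel s t) {n : ℕ} (φ : PPFormula σ ar n) :
    ∀ t, φ.Realize Γ' (fun i => g (t i)) ↔ φ.Realize Γ t := by
  induction φ with
  | eq i j => intro t; exact hg.1.eq_iff
  | rel s v => intro t; exact h s _
  | and φ ψ h1 h2 => intro t; exact and_congr (h1 t) (h2 t)
  | ex φ ih =>
    intro t
    simp only [PPFormula.Realize]
    rw [hg.2.exists]
    refine exists_congr fun d => ?_
    rw [← ih]
    apply iff_of_eq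
    congr 1
    funext i
    refine Fin.lastCases ?_ (fun i => ?_) i <;> simp

theorem FOFormula.realize_iso {σ : Type} {ar : σ → ℕ} {D : Type} {Γ Γ' : RelStruct σ ar D}
    {g : D → D} (hg : Function.Bijective g)
    (h : ∀ s t, Γ'.rel s (fun i => g (t i)) ↔ Γ.rel s t) {n : ℕ} (φ : FOFormula σ ar n) :
    ∀ t, φ.Realize Γ' (fun i => g (t i)) ↔ φ.Realize Γ t := by
  induction φ with
  | eq i j => intro t; exact hg.1.eq_iff
  | rel s v => intro t; exact h s _
  | not φ h1 => intro t; exact not_congr (h1 t)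
  | and φ ψ h1 h2 => intro t; exact and_congr (h1 t) (h2 t)
  | ex φ ih =>
    intro t
    simp only [FOFormula.Realize]
    rw [hg.2.exists]
    refine exists_congr fun d => ?_
    rw [← ih]
    apply iff_of_eq
    congr 1
    funext i
    refine Fin.lastCases ?_ (fun i => ?_) i <;> simp

variable {σ : Type} {ar : σ → ℕ} {Γ : RelStruct σ ar L}

theorem IsReduct.rel_aut (hred : IsReduct C Γ) {g : L → L} (hg : IsCAutomorphism C g) (s : σ)
    (t : Fin (ar s) → L) : Γ.rel s (fun i => g (t i)) ↔ Γ.rel s t := by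
  obtain ⟨φ, h⟩ := hred s
  rw [h, h]
  exact FOFormula.realize_iso hg.1 (fun _ t => hg.2 _ _ _) φ t

theorem PD.aut (hred : IsReduct C Γ) {g : L → L} (hg : IsCAutomorphism C g) {ι : Type}
    {R : (ι → L) → Prop} (h : PD Γ R) (t : ι → L) (ht : R t) : R (fun i => g (t i)) := by
  obtain ⟨n, e, φ, h⟩ := h
  rw [h] at ht ⊢
  exact (PPFormula.realize_iso hg.1 (hred.rel_aut hg) φ _).2 ht

theorem PD.aut_const (hred : IsReduct C Γ) {g : L → L} (hg : IsCAutomorphism C g) {n k : ℕ}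
    (φ : PPFormula (σ ⊕ Fin n) (Sum.elim ar fun _ => 1) k) (a : Fin n → L) (t : Fin k → L) :
    φ.Realize (Γ.withConstants (fun i => g (a i))) (fun i => g (t i)) ↔
      φ.Realize (Γ.withConstants a) t := by
  refine PPFormula.realize_iso hg.1 ?_ φ t
  rintro (s | s) t
  · exact hred.rel_aut hg s t
  · exact hg.1.1.eq_iff

/-- the bundle of assumptions for the hard direction -/
structure Hyp (C : L → L → L → Prop) (Γ : RelStruct σ ar L) : Prop where
  hL : IsHomBBDenseC C
  hred : IsReduct C Γ
  hC : PD Γ (fun t : Fin 3 → L => C (t 0) (t 1) (t 2))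
  hN : ¬ PD Γ (fun t : Fin 3 → L => NRel C (t 0) (t 1) (t 2))

theorem PD.C3 (hC : PD Γ (fun t : Fin 3 → L => C (t 0) (t 1) (t 2))) {ι : Type} [Finite ι]
    (i j k : ι) : PD Γ (fun t : ι → L => C (t i) (t j) (t k)) :=
  hC.reindex ![i, j, k]

theorem PD.tern {M : L → L → L → Prop} (hM : PD Γ (fun t : Fin 3 → L => M (t 0) (t 1) (t 2)))
    {ι : Type} [Finite ι] (i j k : ι) : PD Γ (fun t : ι → L => M (t i) (t j) (t k)) :=
  hM.reindex ![i, j, k]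

theorem PD.quat {M : L → L → L → L → Prop}
    (hM : PD Γ (fun t : Fin 4 → L => M (t 0) (t 1) (t 2) (t 3)))
    {ι : Type} [Finite ι] (i j k l : ι) : PD Γ (fun t : ι → L => M (t i) (t j) (t k) (t l)) :=
  hM.reindex ![i, j, k, l]

theorem Hyp.base (H : Hyp C Γ) {M : L → L → L → Prop}
    (hM : PD Γ (fun t : Fin 3 → L => M (t 0) (t 1) (t 2))) {x1 z1 x2 z2 : L}
    (h1 : x1 ≠ z1) (h2 : x2 ≠ z2) (m1 : M x1 x1 z1) (m2 : M x2 z2 z2) :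
    ∃ x y z, M x y z ∧ C y x z := by
  have hL := H.hL
  by_contra hcon
  push Not at hcon
  have M1 : ∀ x z, x ≠ z → M x x z := by
    intro x z h
    obtain ⟨g, hg, rfl, rfl⟩ := hL.two_trans (x := x1) (z := z1) (x' := x) (z' := z) (by tauto)
    exact PD.aut H.hred hg hM ![x1, x1, z1] m1
  have M2 : ∀ x z, x ≠ z → M x z z := by
    intro x z h
    obtain ⟨g, hg, rfl, rfl⟩ := hL.two_trans (x := x2) (z := z2) (x' := x) (z' := z) (by tauto)
    exact PD.aut H.hred hg hM ![x2, z2, z2] m2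
  apply H.hN
  have key : PD Γ (fun t : Fin 3 ⊕ Fin 2 → L =>
      M (t (.inr 0)) (t (.inl 1)) (t (.inr 1)) ∧ C (t (.inl 2)) (t (.inl 0)) (t (.inr 0)) ∧
      C (t (.inr 1)) (t (.inl 0)) (t (.inr 0)) ∧ C (t (.inl 0)) (t (.inl 2)) (t (.inr 1)) ∧
      C (t (.inr 0)) (t (.inl 2)) (t (.inr 1))) :=
    (hM.tern _ _ _).and ((H.hC.C3 _ _ _).and ((H.hC.C3 _ _ _).and
      ((H.hC.C3 _ _ _).and (H.hC.C3 _ _ _))))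
  refine key.exs.congr fun t => ?_
  simp only [Sum.elim_inl, Sum.elim_inr]
  generalize t 0 = x
  generalize t 1 = y
  generalize t 2 = z
  constructor
  · rintro (h | h)
    · have hzx := hL.ne1 h
      have hzy := hL.ne2 h
      exact ⟨![y, z], M1 _ _ hzy.symm, h, h, hL.self hzx.symm, hL.self hzy.symm⟩
    · have hxy := hL.ne1 h
      have hxz := hL.ne2 h
      exact ⟨![x, y], M2 _ _ hxy, hL.self hxz.symm, hL.self hxy.symm, hL.symm h, hL.symm h⟩
  · rintro ⟨r, h0, h1, h2, h3, h4⟩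
    generalize r 0 = x' at *
    generalize r 1 = z' at *
    have hne : x' ≠ z' := (hL.ne2 h2).symm
    rcases hL.tri (y := y) hne with h | h | h
    · left
      exact hL.symm (hL.move (hL.trans' (hL.symm h) (hL.symm h2)) (hL.symm h2) h4)
    · exact absurd h (hcon _ _ _ h0)
    · right
      exact hL.move (hL.trans' h (hL.symm h4)) (hL.symm h4) h2

theorem Hyp.H3 (H : Hyp C Γ) {M : L → L → L → Prop}
    (hM : PD Γ (fun t : Fin 3 → L => M (t 0) (t 1) (t 2))) {x1 y1 z1 x2 y2 z2 : L}
    (m1 : M x1 y1 z1) (h1 : C z1 x1 y1) (m2 : M x2 y2 z2) (h2 : C x2 y2 z2) :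
    ∃ x y z, M x y z ∧ C y x z := by
  have hL := H.hL
  have key : PD Γ (fun t : Fin 3 ⊕ Fin 2 → L =>
      M (t (.inr 0)) (t (.inl 1)) (t (.inr 1)) ∧ C (t (.inr 1)) (t (.inr 0)) (t (.inl 0)) ∧
      C (t (.inl 2)) (t (.inr 0)) (t (.inl 0)) ∧ C (t (.inr 0)) (t (.inr 1)) (t (.inl 2)) ∧
      C (t (.inl 0)) (t (.inr 1)) (t (.inl 2))) :=
    (hM.tern _ _ _).and ((H.hC.C3 _ _ _).and ((H.hC.C3 _ _ _).and
      ((H.hC.C3 _ _ _).and (H.hC.C3 _ _ _))))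
  have key2 := key.exs
  simp only [Sum.elim_inl, Sum.elim_inr] at key2
  obtain ⟨x', y, z', ⟨r, m, a1, a2, a3, a4⟩, hc⟩ := H.base (M := fun x' y z' => ∃ r : Fin 2 → L,
    M (r 0) y (r 1) ∧ C (r 1) (r 0) x' ∧ C z' (r 0) x' ∧ C (r 0) (r 1) z' ∧ C x' (r 1) z') key2
    (hL.ne2 h1).symm (hL.ne1 h2)
    ⟨![x1, z1], m1, h1, h1, hL.self (hL.ne1 h1).symm, hL.self (hL.ne2 h1).symm⟩
    ⟨![x2, z2], m2, hL.self (hL.ne2 h2).symm, hL.self (hL.ne1 h2).symm, hL.symm h2, hL.symm h2⟩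
  refine ⟨_, _, _, m, ?_⟩
  rcases hL.cut hc (r 0) with h | h
  · exact absurd h (hL.asymm (hL.symm a2))
  rcases hL.cut (hL.symm h) (r 1) with h' | h'
  · exact absurd h' (hL.asymm (hL.symm a3))
  · exact hL.symm h'

theorem Hyp.H4 (H : Hyp C Γ) {M : L → L → L → L → Prop}
    (hM : PD Γ (fun t : Fin 4 → L => M (t 0) (t 1) (t 2) (t 3))) {a b b' c c' d : L}
    (m1 : M a a b b') (h1 : b ≠ b') (m2 : M c c' d d) (h2 : c ≠ c') :
    ∃ x y z w, M x y z w ∧ x ≠ y ∧ z ≠ w := by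
  have hL := H.hL
  by_contra hcon
  push Not at hcon
  have key : PD Γ (fun t : Fin 3 ⊕ Fin 3 → L =>
      M (t (.inl 0)) (t (.inl 1)) (t (.inr 1)) (t (.inr 2)) ∧
      M (t (.inr 0)) (t (.inr 1)) (t (.inl 1)) (t (.inl 2)) ∧
      C (t (.inr 0)) (t (.inr 2)) (t (.inr 2))) :=
    (hM.quat _ _ _ _).and ((hM.quat _ _ _ _).and (H.hC.C3 _ _ _))
  have key2 := key.exs
  simp only [Sum.elim_inl, Sum.elim_inr] at key2
  obtain ⟨g, hg, ga, gb⟩ := hL.two_trans (x := a) (z := b) (x' := b) (z' := a) eq_comm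
  obtain ⟨k, hk, kd, kc'⟩ := hL.two_trans (x := d) (z := c') (x' := c') (z' := d) eq_comm
  have n1 := PD.aut H.hred hg hM ![a, a, b, b'] m1
  have n2 := PD.aut H.hred hk hM ![c, c', d, d] m2
  simp [ga, gb, kd, kc'] at n1 n2
  obtain ⟨x, y, z, ⟨r, p1, p2, p3⟩, hc⟩ := H.base (M := fun x y z => ∃ r : Fin 3 → L,
    M x y (r 1) (r 2) ∧ M (r 0) (r 1) y z ∧ C (r 0) (r 2) (r 2)) key2
    (x1 := a) (z1 := g b') (x2 := c) (z2 := c')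
    (by rw [← gb]; exact fun h => h1 (hg.1.1 h)) h2
    ⟨![b, b, b'], m1, n1, hL.self h1⟩
    ⟨![k c, d, d], m2, n2, hL.self (by rw [← kc']; exact fun h => h2 (hk.1.1 h))⟩
  have e1 := hcon _ _ _ _ p1 (hL.ne1 hc).symm
  refine hL.ne2 hc (hcon _ _ _ _ p2 ?_)
  rw [e1]
  exact hL.ne1 p3

/-- common atoms are preserved -/
def Pres (C : L → L → L → Prop) {ι : Type} (p q u : ι → L) : Prop :=
  ∀ i j k, C (p i) (p j) (p k) → C (q i) (q j) (q k) → C (u i) (u j) (u k)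

theorem Hyp.pd_pres (H : Hyp C Γ) {ι : Type} {R : (ι → L) → Prop} (hR : PD Γ R) (p q : ι → L) :
    PD Γ (fun t => R t ∧ Pres C p q t) := by
  have := hR.fin
  refine (PD.all' hR (β := ι × ι × ι)
    (fun b => C (p b.1) (p b.2.1) (p b.2.2) ∧ C (q b.1) (q b.2.1) (q b.2.2))
    (A := fun b t => C (t b.1) (t b.2.1) (t b.2.2)) (fun b => H.hC.C3 _ _ _)).congr fun t => ?_
  simp [Pres]

theorem Hyp.comb3 (H : Hyp C Γ) {ι : Type} {R : (ι → L) → Prop} (hR : PD Γ R) {p q : ι → L}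
    (hp : R p) (hq : R q) {a b c : ι} (h1 : C (p c) (p a) (p b)) (h2 : C (q a) (q b) (q c)) :
    ∃ u, R u ∧ C (u b) (u a) (u c) ∧ Pres C p q u := by
  have h := (H.pd_pres hR p q).proj ![a, b, c]
  simp only [Fin.forall_fin_succ] at h
  obtain ⟨x, y, z, ⟨t, ⟨ht, ht'⟩, e0, e1, e2⟩, hc⟩ := H.H3
    (M := fun x y z => ∃ t, (R t ∧ Pres C p q t) ∧ t a = x ∧ t b = y ∧ t c = z)
    (h.congr fun t => by simp)
    ⟨p, ⟨hp, fun _ _ _ h _ => h⟩, rfl, rfl, rfl⟩ h1 ⟨q, ⟨hq, fun _ _ _ _ h => h⟩, rfl, rfl, rfl⟩ h2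
  subst e0 e1 e2
  exact ⟨t, ht, hc, ht'⟩

theorem Hyp.comb4 (H : Hyp C Γ) {ι : Type} {R : (ι → L) → Prop} (hR : PD Γ R) {p q : ι → L}
    (hp : R p) (hq : R q) {a b c d : ι} (h1 : p a = p b) (h2 : p c ≠ p d) (h3 : q a ≠ q b)
    (h4 : q c = q d) :
    ∃ u, R u ∧ u a ≠ u b ∧ u c ≠ u d ∧ Pres C p q u := by
  have h := (H.pd_pres hR p q).proj ![a, b, c, d]
  obtain ⟨x, y, z, w, ⟨t, ⟨ht, ht'⟩, e0, e1, e2, e3⟩, hc⟩ := H.H4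
    (M := fun x y z w => ∃ t, (R t ∧ Pres C p q t) ∧ t a = x ∧ t b = y ∧ t c = z ∧ t d = w)
    (h.congr fun t => by simp [Fin.forall_fin_succ])
    ⟨p, ⟨hp, fun _ _ _ h _ => h⟩, rfl, h1.symm, rfl, rfl⟩ h2
    ⟨q, ⟨hq, fun _ _ _ _ h => h⟩, rfl, rfl, rfl, h4.symm⟩ h3
  subst e0 e1 e2 e3
  exact ⟨t, ht, hc.1, hc.2, ht'⟩

/-- all common atoms of `X, Y` are common atoms of `X', Y'` -/
def Keep (C : L → L → L → Prop) {ι : Type} (X Y X' Y' : ι → L) : Prop :=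
  ∀ i j k, C (X i) (X j) (X k) → C (Y i) (Y j) (Y k) →
    C (X' i) (X' j) (X' k) ∧ C (Y' i) (Y' j) (Y' k)

theorem Pres.keep {ι : Type} {X Y X' Y' : ι → L} {u : ι ⊕ ι → L}
    (h : Pres C (Sum.elim X Y) (Sum.elim X' Y') u) (X0 Y0 : ι → L) (h1 : Keep C X0 Y0 X Y)
    (h2 : Keep C X0 Y0 X' Y') :
    Keep C X0 Y0 (fun i => u (.inl i)) (fun i => u (.inr i)) := by
  intro i j k a b
  obtain ⟨c1, c2⟩ := h1 i j k a b
  obtain ⟨d1, d2⟩ := h2 i j k a b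
  exact ⟨h (.inl i) (.inl j) (.inl k) c1 d1, h (.inr i) (.inr j) (.inr k) c2 d2⟩

theorem Hyp.step (H : Hyp C Γ) {ι : Type} {R : (ι ⊕ ι → L) → Prop} (hR : PD Γ R)
    (hs : ∀ X Y : ι → L, R (Sum.elim X Y) → R (Sum.elim Y X)) {X Y : ι → L}
    (hXY : R (Sum.elim X Y)) {a b c : ι} (h1 : C (X a) (X b) (X c)) (h2 : C (Y b) (Y a) (Y c)) :
    ∃ U V : ι → L, R (Sum.elim U V) ∧ Keep C X Y U V ∧
      ((C (U a) (U b) (U c) ∧ C (V a) (V b) (V c)) ∨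
       (C (U b) (U a) (U c) ∧ C (V b) (V a) (V c)) ∨
       (C (U c) (U a) (U b) ∧ C (V c) (V a) (V b))) := by
  have hL := H.hL
  have split : ∀ u : ι ⊕ ι → L, Sum.elim (fun i => u (.inl i)) (fun i => u (.inr i)) = u := by
    intro u; funext i; cases i <;> rfl
  have k0 : Keep C X Y X Y := fun _ _ _ a b => ⟨a, b⟩
  have k1 : Keep C X Y Y X := fun _ _ _ a b => ⟨b, a⟩
  obtain ⟨u, hu, hc, hpres⟩ := H.comb3 hR hXY (hs _ _ hXY)
    (a := .inl b) (b := .inl c) (c := .inl a) h1 (hL.symm h2)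
  have kuv := hpres.keep X Y k0 k1
  rw [← split u] at hu
  generalize hU : (fun i => u (.inl i)) = U at *
  generalize hV : (fun i => u (.inr i)) = V at *
  replace hc : C (U c) (U b) (U a) := by rw [← hU]; exact hc
  have hne : V a ≠ V b := hL.ne1 (kuv a b b (hL.self (hL.ne1 h1)) (hL.self (hL.ne1 h2).symm)).2
  rcases hL.tri (y := V c) hne with h | h | h
  · -- V odd b
    obtain ⟨w, hw, hcw, hpw⟩ := H.comb3 hR hu hXY
      (a := .inl a) (b := .inl b) (c := .inl c) (hL.symm hc) h1
    have kw := hpw.keep X Y kuv k0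
    rw [← split w] at hw
    exact ⟨_, _, hw, kw, Or.inr (Or.inl ⟨hcw, hpw (.inr b) (.inr a) (.inr c) h h2⟩)⟩
  · exact ⟨U, V, hu, kuv, Or.inr (Or.inr ⟨hL.symm hc, h⟩)⟩
  · have kvu : Keep C X Y V U := fun i j k a b => (kuv i j k a b).symm
    obtain ⟨w, hw, hcw, hpw⟩ := H.comb3 hR (hs _ _ hu) hXY
      (a := .inr b) (b := .inr a) (c := .inr c) hc h2
    have kw := hpw.keep X Y kvu k0
    rw [← split w] at hw
    exact ⟨_, _, hw, kw, Or.inl ⟨hpw (.inl a) (.inl b) (.inl c) (hL.symm h) h1, hcw⟩⟩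

/-- pseudo-loop lemma -/
theorem Hyp.loop (H : Hyp C Γ) {ι : Type} [Finite ι] {R : (ι ⊕ ι → L) → Prop} (hR : PD Γ R)
    (hs : ∀ X Y : ι → L, R (Sum.elim X Y) → R (Sum.elim Y X)) {X0 Y0 : ι → L}
    (h0 : R (Sum.elim X0 Y0)) :
    ∃ X Y : ι → L, R (Sum.elim X Y) ∧ ∃ g, IsCAutomorphism C g ∧ ∀ i, g (X i) = Y i := by
  classical
  have := Fintype.ofFinite ι
  have hL := H.hL
  have split : ∀ u : ι ⊕ ι → L, Sum.elim (fun i => u (.inl i)) (fun i => u (.inr i)) = u := by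
    intro u; funext i; cases i <;> rfl
  let A : (ι → L) × (ι → L) → Finset (ι × ι × ι) := fun P => Finset.univ.filter fun b =>
    C (P.1 b.1) (P.1 b.2.1) (P.1 b.2.2) ∧ C (P.2 b.1) (P.2 b.2.1) (P.2 b.2.2)
  have hA : ∀ P i j k, (i, j, k) ∈ A P ↔
    C (P.1 i) (P.1 j) (P.1 k) ∧ C (P.2 i) (P.2 j) (P.2 k) := by
    intro P i j k; simp [A]
  have hwf : WellFounded (fun P Q : (ι → L) × (ι → L) =>
      Fintype.card (ι × ι × ι) - (A P).card < Fintype.card (ι × ι × ι) - (A Q).card) :=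
    (measure fun P => Fintype.card (ι × ι × ι) - (A P).card).wf
  obtain ⟨⟨X, Y⟩, hXY, hmin⟩ := hwf.has_min {P | R (Sum.elim P.1 P.2)} ⟨(X0, Y0), h0⟩
  simp only [Set.mem_ofPred_eq] at hXY hmin
  have hmax : ∀ U V, R (Sum.elim U V) → Keep C X Y U V → ∀ i j k, C (U i) (U j) (U k) →
      C (V i) (V j) (V k) → C (X i) (X j) (X k) ∧ C (Y i) (Y j) (Y k) := by
    intro U V hUV hk i j k c1 c2
    by_contra hcon
    have hss : A (X, Y) ⊂ A (U, V) := by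
      refine (Finset.ssubset_iff_of_subset ?_).2 ⟨(i, j, k), (hA _ _ _ _).2 ⟨c1, c2⟩,
        fun h => hcon ((hA _ _ _ _).1 h)⟩
      rintro ⟨i, j, k⟩ h
      rw [hA] at h ⊢
      exact hk _ _ _ h.1 h.2
    have := Finset.card_lt_card hss
    have h2 : (A (U, V)).card ≤ Fintype.card (ι × ι × ι) := Finset.card_le_univ _
    have := hmin (U, V) hUV
    omega
  have k0 : Keep C X Y X Y := fun _ _ _ a b => ⟨a, b⟩
  have k1 : Keep C X Y Y X := fun _ _ _ a b => ⟨b, a⟩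
  have heq : ∀ i j, X i = X j ↔ Y i = Y j := by
    intro i j
    have aux : ∀ X' Y' : ι → L, R (Sum.elim X' Y') → R (Sum.elim Y' X') → Keep C X Y X' Y' →
        X' i = X' j → Y' i ≠ Y' j → X i ≠ X j ∧ Y i ≠ Y j := by
      intro X' Y' r1 r2 k h1 h2
      obtain ⟨u, hu, hu1, hu2, hp⟩ := H.comb4 hR r1 r2
        (a := .inl i) (b := .inl j) (c := .inr i) (d := .inr j) h1 h2 h2 h1
      have ku := hp.keep X Y k (fun i j l a b => (k i j l a b).symm)
      rw [← split u] at hu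
      have := hmax _ _ hu ku i j j (hL.self hu1) (hL.self hu2)
      exact ⟨hL.ne1 this.1, hL.ne1 this.2⟩
    constructor
    · intro h
      by_contra h'
      exact (aux X Y hXY (hs _ _ hXY) k0 h h').1 h
    · intro h
      by_contra h'
      exact (aux Y X (hs _ _ hXY) hXY k1 h h').2 h
  refine ⟨X, Y, hXY, hL.hom_ext X Y (fun i j => (heq i j).1) ?_⟩
  intro i j k h
  by_cases hjk : X j = X k
  · rw [(heq j k).1 hjk]
    exact hL.self (fun e => hL.ne2 h ((heq i k).2 e))
  have hY1 : Y i ≠ Y j := fun e => hL.ne1 h ((heq _ _).2 e)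
  have hY2 : Y i ≠ Y k := fun e => hL.ne2 h ((heq _ _).2 e)
  have hY3 : Y j ≠ Y k := fun e => hjk ((heq _ _).2 e)
  rcases hL.tri (y := Y k) hY1 with h' | h' | h'
  · obtain ⟨U, V, hUV, hk, h3⟩ := H.step hR hs hXY h h'
    rcases h3 with h3 | h3 | h3
    · exact (hmax U V hUV hk _ _ _ h3.1 h3.2).2
    · exact absurd h (fun h => hL.asymm (hL.symm h) (hL.symm (hmax U V hUV hk _ _ _ h3.1 h3.2).1))
    · exact absurd h (fun h => hL.asymm h (hL.symm (hmax U V hUV hk _ _ _ h3.1 h3.2).1))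
  · obtain ⟨U, V, hUV, hk, h3⟩ := H.step hR hs hXY (hL.symm h) h'
    rcases h3 with h3 | h3 | h3
    · exact hL.symm (hmax U V hUV hk _ _ _ h3.1 h3.2).2
    · exact absurd h (fun h => hL.asymm h (hL.symm (hmax U V hUV hk _ _ _ h3.1 h3.2).1))
    · exact absurd h (fun h => hL.asymm (hL.symm h) (hL.symm (hmax U V hUV hk _ _ _ h3.1 h3.2).1))
  · exact hL.symm h'

theorem Hyp.no_interp (H : Hyp C Γ) {n : ℕ} (a : Fin n → L)
    (I : PPInterpretation (Γ.withConstants a) NAEStruct) : False := by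
  have hL := H.hL
  obtain ⟨s, hs, hs'⟩ := I.coord_surj false
  obtain ⟨t, ht, ht'⟩ := I.coord_surj true
  have swapcase : ∀ x y, I.domFml.Realize (Γ.withConstants a) x →
      I.domFml.Realize (Γ.withConstants a) y →
      ((I.relFml ()).Realize (Γ.withConstants a) (flattenTuple ![x, y, y]) ↔
        I.coord x ≠ I.coord y) := by
    intro x y hx hy
    have h := I.rel_iff () ![x, y, y] (by
      intro (i : Fin 3)
      fin_cases i
      · exact hx
      · exact hy
      · exact hy)
    refine h.symm.trans ?_
    change ((∃ i : Fin 3, I.coord (![x, y, y] i) = true) ∧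
      (∃ i : Fin 3, I.coord (![x, y, y] i) = false)) ↔ _
    simp only [Fin.exists_fin_succ]
    simp
    generalize I.coord x = p
    generalize I.coord y = q
    revert p q
    decide
  let ι := Fin I.dim ⊕ (Fin n ⊕ Fin I.dim)
  let S : Fin n ⊕ Fin I.dim → L := Sum.elim a s
  let Q : (ι ⊕ ι → L) → Prop := fun t =>
    (((I.domFml.Realize (Γ.withConstants (fun i => t (.inl (.inr (.inl i)))))
      (fun i => t (.inl (.inl i))) ∧
    (I.relFml ()).Realize (Γ.withConstants (fun i => t (.inl (.inr (.inl i)))))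
      (fun j => t (flattenTuple ![fun i => .inl (.inl i), fun i => .inr (.inl i),
        fun i => .inr (.inl i)] j))) ∧
    (∀ k, t (.inl (.inr k)) = t (.inr (.inr k)))) ∧
    (∀ e : (Fin n ⊕ Fin I.dim) × (Fin n ⊕ Fin I.dim), S e.1 = S e.2 →
      t (.inl (.inr e.1)) = t (.inl (.inr e.2)))) ∧
    (∀ e : (Fin n ⊕ Fin I.dim) × (Fin n ⊕ Fin I.dim) × (Fin n ⊕ Fin I.dim),
      C (S e.1) (S e.2.1) (S e.2.2) →
      C (t (.inl (.inr e.1))) (t (.inl (.inr e.2.1))) (t (.inl (.inr e.2.2))))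
  have hQ : PD Γ Q := by
    refine PD.all' (PD.all' (PD.all (PD.and ?_ ?_) ?_) _ ?_) _ ?_
    · exact (PD.unconst I.domFml).reindex (κ := ι ⊕ ι)
        (Sum.elim (fun i => .inl (.inl i)) (fun i => .inl (.inr (.inl i))))
    · exact (PD.unconst (I.relFml ())).reindex (κ := ι ⊕ ι)
        (Sum.elim (fun j => (flattenTuple ![fun i => .inl (.inl i), fun i => .inr (.inl i),
        fun i => .inr (.inl i)] j)) (fun i => .inl (.inr (.inl i))))
    · exact fun b => PD.eq _ _
    · exact fun b => PD.eq _ _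
    · exact fun b => H.hC.C3 _ _ _
  have hR : PD Γ (fun t => Q t ∧ Q (fun i => t i.swap)) := hQ.and (hQ.reindex Sum.swap)
  have hflat : ∀ (X Y : ι → L) , (fun j => Sum.elim X Y (flattenTuple
      ![fun i => .inl (.inl i), fun i => .inr (.inl i), fun i => .inr (.inl i)] j)) =
      flattenTuple ![fun i => X (.inl i), fun i => Y (.inl i), fun i => Y (.inl i)] := by
    intro X Y
    funext j
    simp only [flattenTuple]
    generalize (finProdFinEquiv.symm j).2 = m
    generalize (finProdFinEquiv.symm j).1 = l
    fin_cases l <;> rfl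
  have hst : Q (Sum.elim (Sum.elim s S) (Sum.elim t S)) := by
    refine ⟨⟨⟨⟨hs, ?_⟩, fun k => rfl⟩, fun e he => he⟩, fun e he => he⟩
    rw [hflat]
    exact (swapcase s t hs ht).2 (by simp [hs', ht'])
  have hts : Q (Sum.elim (Sum.elim t S) (Sum.elim s S)) := by
    refine ⟨⟨⟨⟨ht, ?_⟩, fun k => rfl⟩, fun e he => he⟩, fun e he => he⟩
    rw [hflat]
    exact (swapcase t s ht hs).2 (by simp [hs', ht'])
  have hsw : ∀ X Y : ι → L, (fun i => Sum.elim X Y (Sum.swap i)) = Sum.elim Y X := by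
    intro X Y; funext i; cases i <;> rfl
  obtain ⟨X, Y, ⟨hXY, hYX⟩, g, hg, hgXY⟩ := H.loop hR (X0 := Sum.elim s S) (Y0 := Sum.elim t S)
    (by
      rintro X Y ⟨h1, h2⟩
      rw [hsw] at h2 ⊢
      exact ⟨h2, h1⟩)
    ⟨hst, by rw [hsw]; exact hts⟩
  rw [hsw] at hYX
  obtain ⟨⟨⟨⟨hx, hrel⟩, hk⟩, he1⟩, he2⟩ := hXY
  obtain ⟨⟨⟨⟨hy, -⟩, -⟩, -⟩, -⟩ := hYX
  rw [hflat] at hrel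
  simp only [Sum.elim_inl, Sum.elim_inr] at hx hy hk he1 he2 hrel
  obtain ⟨h, hh, hhS⟩ := hL.hom_ext S (fun k => X (.inr k)) (fun i j => he1 (i, j))
    (fun i j k => he2 (i, j, k))
  have hb : (fun i => X (.inr (.inl i))) = fun i => h (a i) := by
    funext i; exact (hhS (.inl i)).symm
  have hb' : (fun i => Y (.inr (.inl i))) = fun i => h (a i) := by
    rw [← hb]; funext i; exact (hk _).symm
  choose x0 hx0 using fun i => hh.1.2 (X (.inl i))
  choose y0 hy0 using fun i => hh.1.2 (Y (.inl i))
  have ex : (fun i => X (.inl i)) = fun i => h (x0 i) := by funext i; rw [hx0]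
  have ey : (fun i => Y (.inl i)) = fun i => h (y0 i) := by funext i; rw [hy0]
  have flat3 : ∀ (f : L → L) (x y : Fin I.dim → L),
      flattenTuple ![fun i => f (x i), fun i => f (y i), fun i => f (y i)] =
      fun j => f (flattenTuple ![x, y, y] j) := by
    intro f x y
    funext j
    simp only [flattenTuple]
    generalize (finProdFinEquiv.symm j).1 = l
    fin_cases l <;> rfl
  have flat2 : ∀ (f : L → L) (x y : Fin I.dim → L),
      flattenTuple ![fun i => f (x i), fun i => f (y i)] =
      fun j => f (flattenTuple ![x, y] j) := by
    intro f x y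
    funext j
    simp only [flattenTuple]
    generalize (finProdFinEquiv.symm j).1 = l
    fin_cases l <;> rfl
  rw [hb, ex, PD.aut_const H.hred hh] at hx
  rw [hb', ey, PD.aut_const H.hred hh] at hy
  rw [hb, ex, ey, flat3, PD.aut_const H.hred hh, swapcase _ _ hx hy] at hrel
  apply hrel
  have key : I.coord x0 = I.coord s ↔ I.coord y0 = I.coord s := by
    rw [I.eq_iff _ _ hx hs, I.eq_iff _ _ hy hs, ← PD.aut_const H.hred hh,
      ← PD.aut_const H.hred hh (t := flattenTuple ![y0, s]), ← flat2 h, ← flat2 h, ← ex, ← ey,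
      ← PD.aut_const H.hred hg, ← flat2 g]
    have e1 : (fun i => g (h (a i))) = fun i => h (a i) := by
      funext i
      rw [← congrFun hb i, hgXY, hk]
    have e2 : (fun i => g (h (s i))) = fun i => h (s i) := by
      funext i
      have := hhS (.inr i)
      simp only [S, Sum.elim_inr] at this
      rw [this, hgXY, hk]
    have e3 : (fun i => g (X (.inl i))) = fun i => Y (.inl i) := by
      funext i; exact hgXY _
    rw [e1, e2, e3]
  rw [hs'] at key
  revert key
  generalize I.coord x0 = p
  generalize I.coord y0 = q
  revert p q
  decide

/-! the easy direction -/

theorem same_side (hL : IsHomBBDenseC C) {a b x y w : L} (hx : NRel C a x b)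
    (hy : NRel C a y b) (hw : NRel C a w b) (h : C a x b ↔ C a y b) (h' : ¬ (C a x b ↔ C a w b)) :
    C w x y := by
  have sep0 : ∀ x w, C b a x → C a w b → C w a x := by
    intro x w h1 h2
    rcases hL.cut h1 w with h | h
    · exact h
    · exact absurd (hL.trans' h (hL.symm h1)) (fun h3 => hL.asymm h2 h3)
  have sep1 : ∀ x w, C a x b → C b a w → C w x b := by
    intro x w h1 h2
    rcases hL.cut h1 w with h | h
    · exact h
    · exact absurd h (fun h3 => hL.asymm (hL.symm h2) h3)
  by_cases e : C a x b
  · have e2 := h.1 e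
    have e3 : ¬ C a w b := fun h3 => h' ⟨fun _ => h3, fun _ => e⟩
    have e4 := hw.resolve_right e3
    exact hL.trans' (sep1 x w e e4) (hL.symm (sep1 y w e2 e4))
  · have e2 : ¬ C a y b := fun h3 => e (h.2 h3)
    have e3 : C a w b := by tauto
    exact hL.trans' (hL.symm (sep0 x w (hx.resolve_right e) e3)) (sep0 y w (hy.resolve_right e2) e3)

theorem between_iff (hL : IsHomBBDenseC C) {a b x y w : L} (hx : NRel C a x b)
    (hy : NRel C a y b) (hw : NRel C a w b) (h : NRel C x w y) :
    (C a w b ↔ C a x b) ∨ (C a w b ↔ C a y b) := by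
  by_contra hc
  rw [not_or] at hc
  have := same_side hL hx hy hw (by tauto) (by tauto)
  rcases h with h | h
  · exact hL.asymm this h
  · exact hL.asymm (hL.symm this) (hL.symm h)

theorem between_of (hL : IsHomBBDenseC C) {a b x y w : L} (hx : NRel C a x b)
    (hy : NRel C a y b) (hw : NRel C a w b) (h : ¬ (C a x b ↔ C a y b)) : NRel C x w y := by
  by_cases e : C a x b ↔ C a w b
  · exact Or.inl (same_side hL hx hw hy e h)
  · exact Or.inr (same_side hL hw hy hx (by tauto) (by tauto))

theorem neq_iff (hL : IsHomBBDenseC C) {a b x y : L} (hab : a ≠ b) (hx : NRel C a x b)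
    (hy : NRel C a y b) :
    (NRel C x a y ∧ NRel C x b y) ↔ (C a x b ↔ ¬ C a y b) := by
  have ha : NRel C a a b := Or.inl (hL.self hab.symm)
  have hb : NRel C a b b := Or.inr (hL.self hab)
  have ha' : ¬ C a a b := fun h => hL.ne1 h rfl
  have hb' : C a b b := hL.self hab
  constructor
  · rintro ⟨h1, h2⟩
    have := between_iff hL hx hy ha h1
    have := between_iff hL hx hy hb h2
    tauto
  · intro h
    exact ⟨between_of hL hx hy ha (by tauto), between_of hL hx hy hb (by tauto)⟩

theorem other (hL : IsHomBBDenseC C) {a b x : L} (hx : NRel C a x b) :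
    ∃ y, y ≠ x ∧ NRel C a y b ∧ (C a y b ↔ C a x b) := by
  by_cases e : C a x b
  · obtain ⟨w, h1, h2⟩ := hL.2.2.2.2.1 a x x (hL.self (hL.ne1 e))
    have := hL.trans' h1 e
    exact ⟨w, hL.ne1 h2, Or.inr this, by tauto⟩
  · have e0 := hx.resolve_right e
    obtain ⟨w, h1, h2⟩ := hL.2.2.2.2.1 b x x (hL.self (hL.ne2 e0))
    have h3 := hL.trans' e0 (hL.symm h1)
    have : ¬ C a w b := fun h => hL.asymm h (hL.symm h3)
    exact ⟨w, hL.ne1 h2, Or.inl h3, by tauto⟩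

theorem nae_iff (hL : IsHomBBDenseC C) {a b x y z : L} (hab : a ≠ b) (k0 : NRel C a x b)
    (k1 : NRel C a y b) (k2 : NRel C a z b) :
    ((C a x b ∨ C a y b ∨ C a z b) ∧ (¬ C a x b ∨ ¬ C a y b ∨ ¬ C a z b)) ↔
      ∃ w : Fin 3 → L, (NRel C a (w 0) b ∧ NRel C a (w 1) b ∧ NRel C a (w 2) b) ∧
        ((NRel C x a (w 1) ∧ NRel C x b (w 1)) ∧ NRel C (w 1) a (w 0) ∧ NRel C (w 1) b (w 0))
        ∧ NRel C (w 0) (w 2) y ∧ NRel C (w 2) a z ∧ NRel C (w 2) b z := by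
  have ha : NRel C a a b := Or.inl (hL.self hab.symm)
  have hb : NRel C a b b := Or.inr (hL.self hab)
  have ha' : ¬ C a a b := fun h => hL.ne1 h rfl
  have hb' : C a b b := hL.self hab
  constructor
  · intro hne
    obtain ⟨u, hu, hu'⟩ : ∃ u, NRel C a u b ∧ (C a u b ↔ ¬ C a x b) := by
      by_cases e : C a x b
      · exact ⟨a, ha, by tauto⟩
      · exact ⟨b, hb, by tauto⟩
    obtain ⟨x', hx', hxd, hxs⟩ : ∃ x', x' ≠ y ∧ NRel C a x' b ∧ (C a x' b ↔ C a x b) := by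
      by_cases e : x = y
      · obtain ⟨x', p, q, r⟩ := other hL k0
        exact ⟨x', by rwa [← e], q, r⟩
      · exact ⟨x, e, k0, Iff.rfl⟩
    have hu1 := (neq_iff hL hab k0 hu).2 (by grind)
    have hu2 := (neq_iff hL hab hu hxd).2 (by grind)
    by_cases e : C a x b ↔ C a z b
    · exact ⟨![x', u, y], ⟨hxd, hu, k1⟩, ⟨hu1, hu2⟩, Or.inr (hL.self hx'),
        (neq_iff hL hab k1 k2).2 (by grind)⟩
    · exact ⟨![x', u, x'], ⟨hxd, hu, hxd⟩, ⟨hu1, hu2⟩, Or.inl (hL.self hx'.symm),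
        (neq_iff hL hab hxd k2).2 (by grind)⟩
  · rintro ⟨w, ⟨w0, w1, w2⟩, ⟨p1, p2⟩, p3, p4⟩
    rw [neq_iff hL hab k0 w1] at p1
    rw [neq_iff hL hab w1 w0] at p2
    rw [neq_iff hL hab w2 k2] at p4
    have := between_iff hL w0 k1 w2 p3
    grind

theorem easy (hL : IsHomBBDenseC C)
    (hN : PD Γ (fun t : Fin 3 → L => NRel C (t 0) (t 1) (t 2))) :
    ∃ (n : ℕ) (a : Fin n → L),
        Nonempty (PPInterpretation (Γ.withConstants a) NAEStruct) := by
  classical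
  obtain ⟨_, hinf, _⟩ := id hL
  obtain ⟨a, b, hab⟩ := exists_pair_ne L
  have ha : NRel C a a b := Or.inl (hL.self hab.symm)
  have hb : NRel C a b b := Or.inr (hL.self hab)
  have ha' : ¬ C a a b := fun h => hL.ne1 h rfl
  have hb' : C a b b := hL.self hab
  have T := fun {ι : Type} [Finite ι] (i j k : ι) => PD.tern (Γ := Γ) hN i j k
  have NQ := fun {ι : Type} [Finite ι] (p q i j : ι) => (T i p j).and (T i q j)
  have D1 := PD.to_pp <| (T (ι := Fin 1 ⊕ Fin 2) (.inr 0) (.inl 0) (.inr 1)).subst ![a, b]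
  have D2 := PD.to_pp <| (PD.exs (κ := Fin (2 * 1) ⊕ Fin 2) (ι := Fin 1)
    (((T (.inl (.inr 0)) (.inr 0) (.inl (.inr 1))).and
      (NQ (.inl (.inr 0)) (.inl (.inr 1)) (.inl (.inl 0)) (.inr 0))).and
      (NQ (.inl (.inr 0)) (.inl (.inr 1)) (.inr 0) (.inl (.inl 1))))).subst ![a, b]
  have D3 := PD.to_pp <| (PD.exs (κ := Fin (3 * 1) ⊕ Fin 2) (ι := Fin 3)
    (((T (.inl (.inr 0)) (.inr 0) (.inl (.inr 1))).and
      ((T (.inl (.inr 0)) (.inr 1) (.inl (.inr 1))).and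
      (T (.inl (.inr 0)) (.inr 2) (.inl (.inr 1))))).and
      (((NQ (.inl (.inr 0)) (.inl (.inr 1)) (.inl (.inl 0)) (.inr 1)).and
      (NQ (.inl (.inr 0)) (.inl (.inr 1)) (.inr 1) (.inr 0))).and
      ((T (.inr 0) (.inr 2) (.inl (.inl 1))).and
      (NQ (.inl (.inr 0)) (.inl (.inr 1)) (.inr 2) (.inl (.inl 2))))))).subst ![a, b]
  obtain ⟨φ1, h1⟩ := D1
  obtain ⟨φ2, h2⟩ := D2
  obtain ⟨φ3, h3⟩ := D3
  simp only [Sum.elim_inl, Sum.elim_inr, Matrix.cons_val_zero, Matrix.cons_val_one] at h1 h2 h3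
  refine ⟨2, ![a, b], ⟨⟨1, φ1, φ2, fun _ => φ3, fun t => decide (C a (t 0) b), ?_, ?_, ?_⟩⟩⟩
  · rintro (_ | _)
    · exact ⟨fun _ => a, (h1 _).1 ha, by simpa using ha'⟩
    · exact ⟨fun _ => b, (h1 _).1 hb, by simpa using hb'⟩
  · intro t1 t2 ht1 ht2
    rw [← h1] at ht1 ht2
    rw [← h2, decide_eq_decide]
    change _ ↔ ∃ w : Fin 1 → L, (NRel C a (w 0) b ∧ NRel C (t1 0) a (w 0) ∧ NRel C (t1 0) b (w 0))
      ∧ NRel C (w 0) a (t2 0) ∧ NRel C (w 0) b (t2 0)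
    constructor
    · intro h
      by_cases e : C a (t1 0) b
      · exact ⟨fun _ => a, ⟨ha, (neq_iff hL hab ht1 ha).2 (by tauto)⟩,
          (neq_iff hL hab ha ht2).2 (by tauto)⟩
      · exact ⟨fun _ => b, ⟨hb, (neq_iff hL hab ht1 hb).2 (by tauto)⟩,
          (neq_iff hL hab hb ht2).2 (by tauto)⟩
    · rintro ⟨w, ⟨hw, k1⟩, k2⟩
      rw [neq_iff hL hab ht1 hw] at k1
      rw [neq_iff hL hab hw ht2] at k2
      tauto
  · intro _ ts hts
    have k0 := (h1 _).2 (hts 0)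
    have k1 := (h1 _).2 (hts 1)
    have k2 := (h1 _).2 (hts 2)
    rw [← h3]
    change ((∃ i : Fin 3, decide (C a (ts i 0) b) = true) ∧ (∃ i : Fin 3, decide (C a (ts i 0) b) = false))
      ↔ ∃ w : Fin 3 → L, (NRel C a (w 0) b ∧ NRel C a (w 1) b ∧ NRel C a (w 2) b) ∧
        ((NRel C (ts 0 0) a (w 1) ∧ NRel C (ts 0 0) b (w 1)) ∧ NRel C (w 1) a (w 0) ∧ NRel C (w 1) b (w 0))
        ∧ NRel C (w 0) (w 2) (ts 1 0) ∧ NRel C (w 2) a (ts 2 0) ∧ NRel C (w 2) b (ts 2 0)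
    generalize hx : ts 0 0 = x at *
    generalize hy : ts 1 0 = y at *
    generalize hz : ts 2 0 = z at *
    have e : ((∃ i : Fin 3, decide (C a (ts i 0) b) = true) ∧
      (∃ i : Fin 3, decide (C a (ts i 0) b) = false)) ↔
      ((C a x b ∨ C a y b ∨ C a z b) ∧ (¬ C a x b ∨ ¬ C a y b ∨ ¬ C a z b)) := by
      simp only [decide_eq_true_eq, decide_eq_false_iff_not]
      rw [← hx, ← hy, ← hz]
      simp [Fin.exists_fin_succ]
    rw [e]
    exact nae_iff hL hab k0 k1 k2

end CLemmas

end Helpers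

/-- **N is pp-definable iff NAE is pp-interpretable with parameters.**
Let `Γ` be a reduct of `(𝕃; C)` such that `C` is primitive positive definable in `Γ`.
Then the relation `N` is primitive positive definable in `Γ` if and only if some
expansion of `Γ` by finitely many constants admits a primitive positive interpretation
of `({0,1}; NAE)`. -/
theorem N_pp_definable_iff_NAE_pp_interpretable
    (L : Type) (C : L → L → L → Prop) (hL : IsHomBBDenseC C)
    (σ : Type) (ar : σ → ℕ) (Γ : RelStruct σ ar L) (hred : IsReduct C Γ)
    (hC : PPDefinable Γ (fun t : Fin 3 → L => C (t 0) (t 1) (t 2))) :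
    PPDefinable Γ (fun t : Fin 3 → L => NRel C (t 0) (t 1) (t 2)) ↔
      ∃ (n : ℕ) (a : Fin n → L),
        Nonempty (PPInterpretation (Γ.withConstants a) NAEStruct) := by
  constructor
  · intro h
    exact easy hL (PD.of_pp h)
  · rintro ⟨n, a, ⟨I⟩⟩
    by_contra hcon
    exact Hyp.no_interp ⟨hL, hred, PD.of_pp hC, fun h => hcon h.to_pp⟩ a I
end

section
/- Let (L;C) be any C-relation in the sense of Adeleke–Neumann (C is a ternary relation on L satisfying: C(z;x,y) → C(z;y,x); C(z;x,y) → ¬C(y;x,z); C(z;x,y) → (C(w;x,y) ∨ C(z;w,y)) for all w; and C(z;x,x) for all x ≠ z) that is binary branching (for pairwise distinct x,y,z, exactly one of C(z;x,y), C(y;x,z), C(x;y,z) holds). Write xy|z for C(z;x,y), and let N_d(x,y,z) abbreviate 'x, y, z are pairwise distinct and (xy|z or x|yz)'. Let a, b ∈ L be distinct and suppose x, y, z ∈ L satisfy ax|b, ay|b, and az|b. Then there do not exist w₁, w₂ ∈ L such that N_d(x,w₁,y), N_d(w₁,w₂,z), N_d(w₁,a,w₂), and N_d(w₁,b,w₂)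 all hold. -/
/-- `N_d(x,y,z)`: `x, y, z` are pairwise distinct and (`xy|z` or `x|yz`), where
`C z x y` encodes `C(z; x, y)`, i.e. `xy|z`. -/
def NdRel {L : Type*} (C : L → L → L → Prop) (x y z : L) : Prop :=
  x ≠ y ∧ x ≠ z ∧ y ≠ z ∧ (C z x y ∨ C x y z)

/-- **The `(0,0,0)` case in the verification of the interpretation of NAE.**
Let `(L; C)` be a binary branching C-relation in the sense of Adeleke–Neumann, let
`a ≠ b` in `L`, and suppose `x, y, z` satisfy `ax|b`, `ay|b`, `az|b`. Then there are no
`w₁, w₂ ∈ L` with `N_d(x,w₁,y)`, `N_d(w₁,w₂,z)`, `N_d(w₁,a,w₂)` and `N_d(w₁,b,w₂)`. -/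
theorem no_witnesses_when_all_on_side_of_a
    (L : Type*) (C : L → L → L → Prop)
    -- the Adeleke–Neumann axioms for a C-relation (`C z x y` means `C(z;x,y)`):
    (h1 : ∀ z x y, C z x y → C z y x)
    (h2 : ∀ z x y, C z x y → ¬ C y x z)
    (h3 : ∀ z x y, C z x y → ∀ w, C w x y ∨ C z w y)
    (h4 : ∀ z x, x ≠ z → C z x x)
    -- binary branching: for pairwise distinct `x, y, z` exactly one of
    -- `C(z;x,y)`, `C(y;x,z)`, `C(x;y,z)` holds:
    (hbb : ∀ x y z : L, x ≠ y → x ≠ z → y ≠ z →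
      (C z x y ∨ C y x z ∨ C x y z) ∧
      (C z x y → ¬ C y x z) ∧ (C z x y → ¬ C x y z) ∧ (C y x z → ¬ C x y z))
    (a b : L) (hab : a ≠ b)
    (x y z : L) (hx : C b a x) (hy : C b a y) (hz : C b a z) :
    ¬ ∃ w₁ w₂ : L,
        NdRel C x w₁ y ∧ NdRel C w₁ w₂ z ∧ NdRel C w₁ a w₂ ∧ NdRel C w₁ b w₂ := by
  -- `{u | bu|..}`: pairs inside a cone avoiding `b` form a transitive relation
  have tr : ∀ p q r, C b q p → C b q r → C b p r := by
    intro p q r hp hr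
    rcases h3 _ _ _ hr p with h | h
    · rcases h3 _ _ _ hp r with h' | h'
      · exact absurd (h1 _ _ _ h') (fun h'' => h2 _ _ _ h (h1 _ _ _ h''))
      · exact h1 _ _ _ h'
    · exact h
  have key : ∀ p q w, C b a p → C b a q → C q p w → C b a w := by
    intro p q w hp hq hw
    have hpq := tr p a q hp hq
    rcases h3 _ _ _ (h1 _ _ _ hw) b with h | h
    · exact tr a p w (h1 _ _ _ hp) (h1 _ _ _ h)
    · exact absurd (h1 _ _ _ h) (h2 _ _ _ hpq)
  rintro ⟨w₁, w₂, ⟨-, -, -, n1⟩, ⟨-, -, -, n2⟩, -, ⟨-, -, -, n4⟩⟩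
  have hw1 : C b a w₁ := by
    rcases n1 with h | h
    · exact key x y w₁ hx hy h
    · exact key y x w₁ hy hx (h1 _ _ _ h)
  have hw2 : C b a w₂ := by
    rcases n2 with h | h
    · exact key w₁ z w₂ hw1 hz h
    · exact key z w₁ w₂ hz hw1 (h1 _ _ _ h)
  have h12 := tr w₁ a w₂ hw1 hw2
  rcases n4 with h | h
  · exact h2 _ _ _ h12 h
  · exact h2 _ _ _ (h1 _ _ _ h12) (h1 _ _ _ h)
end
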